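/- arXiv:2206.02258 — 2 statements merged into one kernel-verified Lean document; each statement's English description precedes it below -/
import Mathlib

section
/- Let f satisfy Assumption (A). If h₂(x) → ∞ as |x| → ∞, or g₂(x) → ∞ as |x| → ∞, then for all integers n > m ≥ 1 one has h_m(x)/h_n(x) → 0 as |x| → ∞. -/
open MeasureTheory Filter Topology ENNReal Set

noncomputable section

/-- The set `D(x) = {z : |z| < |x| - 1, |x - z| < |x| - 1}`. -/
def Dset {d : ℕ} (x : EuclideanSpace ℝ (Fin d)) : Set (EuclideanSpace ℝ (Fin d)) :=
  {z | ‖z‖ < ‖x‖ - 1 ∧ ‖x - z‖ < ‖x‖ - 1}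

/-- The set `E(x) = {z : |z| < |x|, |x - z| < |x|}`. -/
def Eset {d : ℕ} (x : EuclideanSpace ℝ (Fin d)) : Set (EuclideanSpace ℝ (Fin d)) :=
  {z | ‖z‖ < ‖x‖ ∧ ‖x - z‖ < ‖x‖}

/-- `hfun f n` is the function `h_{n+1}`. -/
def hfun {d : ℕ} (f : EuclideanSpace ℝ (Fin d) → ℝ≥0∞) :
    ℕ → EuclideanSpace ℝ (Fin d) → ℝ≥0∞
  | 0 => fun _ => 1
  | n + 1 => fun x => (∫⁻ y in Dset x, f (x - y) * f y * hfun f n y) / f x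

/-- `gfun f n` is the function `g_{n+1}`. -/
def gfun {d : ℕ} (f : EuclideanSpace ℝ (Fin d) → ℝ≥0∞) :
    ℕ → EuclideanSpace ℝ (Fin d) → ℝ≥0∞
  | 0 => fun _ => 1
  | n + 1 => fun x => (∫⁻ y in Eset x, f (x - y) * f y * gfun f n y) / f x

/-- The filter "`|x| → ∞`" on `ℝ^d`. -/
def normAtTop (d : ℕ) : Filter (EuclideanSpace ℝ (Fin d)) :=
  Filter.comap (fun x => ‖x‖) Filter.atTop


theorem aux_vec {d : ℕ} (hd : 0 < d) (r : ℝ) (hr : 0 ≤ r) :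
    ∃ x : EuclideanSpace ℝ (Fin d), ‖x‖ = r :=
  ⟨EuclideanSpace.single (⟨0, hd⟩ : Fin d) r, by simp [abs_of_nonneg hr]⟩

theorem aux_pow (q : ℝ → ℝ≥0∞) (C : ℝ≥0∞)
    (hC : ∀ r s : ℝ, 1 ≤ r → r ≤ s → s ≤ r + 1 → q r ≤ C * q s) (N : ℕ) :
    ∀ r : ℝ, 1 ≤ r → q r ≤ C ^ N * q (r + N) := by
  induction N with
  | zero => intro r _; simp
  | succ N ih =>
    intro r hr
    calc q r ≤ C ^ N * q (r + N) := ih r hr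
      _ ≤ C ^ N * (C * q (r + (N + 1 : ℕ))) := by
          gcongr
          have hN : (0 : ℝ) ≤ N := Nat.cast_nonneg N
          apply hC
          · linarith
          · push_cast; linarith
          · push_cast; linarith
      _ = _ := by rw [pow_succ]; ring

theorem aux_q1 {d : ℕ} (f : EuclideanSpace ℝ (Fin d) → ℝ≥0∞) (hint : ∫⁻ x, f x ≠ ⊤)
    (q : ℝ → ℝ≥0∞) (hq : Antitone q) (hfq : ∀ x, f x = q ‖x‖) : q 1 ≠ ⊤ := by
  intro h
  apply hint
  rw [eq_top_iff]
  have hb : volume (Metric.ball (0 : EuclideanSpace ℝ (Fin d)) 1) ≠ 0 :=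
    (Metric.measure_ball_pos volume _ one_pos).ne'
  calc (⊤ : ℝ≥0∞) = ∫⁻ _ in Metric.ball (0 : EuclideanSpace ℝ (Fin d)) 1, ⊤ := by
        rw [setLIntegral_const, ENNReal.top_mul hb]
    _ ≤ ∫⁻ x in Metric.ball (0 : EuclideanSpace ℝ (Fin d)) 1, f x := by
        apply setLIntegral_mono' Metric.isOpen_ball.measurableSet
        intro x hx
        rw [hfq, ← h]
        exact hq (by simpa using (mem_ball_zero_iff.1 hx).le)
    _ ≤ _ := setLIntegral_le_lintegral _ _

theorem aux_Dset {d : ℕ} (x : EuclideanSpace ℝ (Fin d)) : MeasurableSet (Dset x) := by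
  have : IsOpen (Dset x) := by
    apply IsOpen.inter
    · exact isOpen_lt (f := fun z : EuclideanSpace ℝ (Fin d) => ‖z‖) (g := fun _ => ‖x‖ - 1)
        (by fun_prop) (by fun_prop)
    · exact isOpen_lt (f := fun z : EuclideanSpace ℝ (Fin d) => ‖x - z‖) (g := fun _ => ‖x‖ - 1)
        (by fun_prop) (by fun_prop)
  exact this.measurableSet

theorem aux_Eset {d : ℕ} (x : EuclideanSpace ℝ (Fin d)) : MeasurableSet (Eset x) := by
  have : IsOpen (Eset x) := by
    apply IsOpen.inter
    · exact isOpen_lt (f := fun z : EuclideanSpace ℝ (Fin d) => ‖z‖) (g := fun _ => ‖x‖)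
        (by fun_prop) (by fun_prop)
    · exact isOpen_lt (f := fun z : EuclideanSpace ℝ (Fin d) => ‖x - z‖) (g := fun _ => ‖x‖)
        (by fun_prop) (by fun_prop)
  exact this.measurableSet

theorem aux_bdd {d : ℕ} (hd : 0 < d) (f : EuclideanSpace ℝ (Fin d) → ℝ≥0∞)
    (hpos : ∀ x, 0 < f x) (hint : ∫⁻ x, f x ≠ ⊤)
    (q : ℝ → ℝ≥0∞) (hq : Antitone q) (hfq : ∀ x, f x = q ‖x‖) (n : ℕ) :
    ∀ R : ℝ, 0 ≤ R → ∃ M : ℝ≥0∞, M ≠ ⊤ ∧ ∀ y : EuclideanSpace ℝ (Fin d),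
      ‖y‖ ≤ R → hfun f n y ≤ M := by
  induction n with
  | zero => intro R _; exact ⟨1, by simp, fun y _ => le_rfl⟩
  | succ n ih =>
    intro R hR
    obtain ⟨M, hM, hb⟩ := ih R hR
    obtain ⟨v, hv⟩ := aux_vec hd R hR
    have hqR : q R ≠ 0 := by rw [← hv, ← hfq]; exact (hpos v).ne'
    have hq1 := aux_q1 f hint q hq hfq
    refine ⟨(q 1 * M) * (∫⁻ x, f x) / q R,
      ENNReal.div_ne_top (ENNReal.mul_ne_top (ENNReal.mul_ne_top hq1 hM) hint) hqR, ?_⟩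
    intro y hy
    change (∫⁻ z in Dset y, f (y - z) * f z * hfun f n z) / f y ≤ _
    have hfy : q R ≤ f y := by rw [hfq]; exact hq hy
    refine ENNReal.div_le_div ?_ hfy
    calc ∫⁻ z in Dset y, f (y - z) * f z * hfun f n z
        ≤ ∫⁻ z in Dset y, (q 1 * M) * f z := by
          apply setLIntegral_mono' (aux_Dset y)
          intro z hz
          obtain ⟨h1, h2⟩ := hz
          have h3 : f (y - z) ≤ q 1 := by
            rw [hfq]; apply hq
            have := norm_sub_norm_le y z
            linarith
          have h4 := hb z (by linarith)
          calc f (y - z) * f z * hfun f n z ≤ q 1 * f z * M := by gcongr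
            _ = _ := by ring
      _ = (q 1 * M) * ∫⁻ z in Dset y, f z :=
          lintegral_const_mul' _ _ (ENNReal.mul_ne_top hq1 hM)
      _ ≤ _ := by gcongr; exact Measure.restrict_le_self

theorem aux_ev {d : ℕ} {p : EuclideanSpace ℝ (Fin d) → Prop} :
    (∀ᶠ x in normAtTop d, p x) ↔ ∃ R : ℝ, ∀ x, R ≤ ‖x‖ → p x := by
  rw [normAtTop, (atTop_basis.comap _).eventually_iff]
  simp

theorem aux_step {d : ℕ} (hd : 0 < d) (f : EuclideanSpace ℝ (Fin d) → ℝ≥0∞)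
    (hmeas : Measurable f) (hpos : ∀ x, 0 < f x) (hint : ∫⁻ x, f x ≠ ⊤)
    (q : ℝ → ℝ≥0∞) (hq : Antitone q) (hfq : ∀ x, f x = q ‖x‖)
    (C : ℝ≥0∞) (hCt : C ≠ ⊤)
    (hC : ∀ r s : ℝ, 1 ≤ r → r ≤ s → s ≤ r + 1 → q r ≤ C * q s) (n : ℕ)
    (ε : ℝ≥0∞) (hε : ε ≠ ⊤)
    (h : ∀ᶠ x in normAtTop d, hfun f n x ≤ ε * hfun f (n + 1) x) :
    ∃ K : ℝ≥0∞, K ≠ ⊤ ∧ ∀ᶠ x in normAtTop d, hfun f (n + 1) x ≤ ε * hfun f (n + 2) x + K := by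
  obtain ⟨R, hR⟩ := aux_ev.1 h
  obtain ⟨N, hN⟩ := exists_nat_ge R
  have hN0 : (0 : ℝ) ≤ N := Nat.cast_nonneg N
  obtain ⟨M, hM, hb⟩ := aux_bdd hd f hpos hint q hq hfq n N hN0
  refine ⟨C ^ N * M * ∫⁻ x, f x,
    ENNReal.mul_ne_top (ENNReal.mul_ne_top (ENNReal.pow_ne_top hCt) hM) hint, ?_⟩
  refine aux_ev.2 ⟨N + 1, fun x hx => ?_⟩
  have key : ∫⁻ y in Dset x, f (x - y) * f y * hfun f n y ≤
      ε * (∫⁻ y in Dset x, f (x - y) * f y * hfun f (n + 1) y)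
        + (C ^ N * M * ∫⁻ x, f x) * f x := by
    calc ∫⁻ y in Dset x, f (x - y) * f y * hfun f n y
        ≤ ∫⁻ y in Dset x, (ε * (f (x - y) * f y * hfun f (n + 1) y)
            + (C ^ N * f x * M) * f y) := by
          apply lintegral_mono
          intro y
          by_cases hy : R ≤ ‖y‖
          · refine le_trans ?_ le_self_add
            calc f (x - y) * f y * hfun f n y
                ≤ f (x - y) * f y * (ε * hfun f (n + 1) y) := by gcongr; exact hR y hy
              _ = _ := by ring
          · push Not at hy
            refine le_trans ?_ le_add_self
            have h1 : f (x - y) ≤ C ^ N * f x := by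
              rw [hfq, hfq]
              have h2 := aux_pow q C hC N (‖x‖ - N) (by linarith)
              rw [sub_add_cancel] at h2
              refine le_trans (hq ?_) h2
              have := norm_sub_norm_le x y
              linarith
            have h4 := hb y (by linarith)
            calc f (x - y) * f y * hfun f n y ≤ (C ^ N * f x) * f y * M := by gcongr
              _ = _ := by ring
      _ = ε * (∫⁻ y in Dset x, f (x - y) * f y * hfun f (n + 1) y)
            + (C ^ N * f x * M) * ∫⁻ y in Dset x, f y := by
          rw [lintegral_add_right _ (hmeas.const_mul _), lintegral_const_mul' _ _ hε,
            lintegral_const_mul _ hmeas]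
      _ ≤ ε * (∫⁻ y in Dset x, f (x - y) * f y * hfun f (n + 1) y)
            + (C ^ N * f x * M) * ∫⁻ y, f y := by
          gcongr; exact Measure.restrict_le_self
      _ = _ := by ring
  change (∫⁻ y in Dset x, f (x - y) * f y * hfun f n y) / f x ≤
    ε * ((∫⁻ y in Dset x, f (x - y) * f y * hfun f (n + 1) y) / f x) + _
  refine (ENNReal.div_le_div_right key _).trans ?_
  rw [ENNReal.add_div, mul_div_assoc]
  gcongr
  exact ENNReal.div_le_of_le_mul le_rfl

theorem aux_g {d : ℕ} (f : EuclideanSpace ℝ (Fin d) → ℝ≥0∞)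
    (hmeas : Measurable f)
    (q : ℝ → ℝ≥0∞) (hq : Antitone q) (hfq : ∀ x, f x = q ‖x‖)
    (C : ℝ≥0∞) 
    (hC : ∀ r s : ℝ, 1 ≤ r → r ≤ s → s ≤ r + 1 → q r ≤ C * q s) :
    ∀ᶠ x in normAtTop d, gfun f 1 x ≤ hfun f 1 x + 2 * C * ∫⁻ x, f x := by
  refine aux_ev.2 ⟨2, fun x hx => ?_⟩
  have key : ∫⁻ y in Eset x, f (x - y) * f y * 1 ≤
      (∫⁻ y in Dset x, f (x - y) * f y * 1) + (2 * C * ∫⁻ x, f x) * f x := by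
    have hfar : ∀ z : EuclideanSpace ℝ (Fin d), ‖x‖ - 1 ≤ ‖z‖ → f z ≤ C * f x := by
      intro z hz
      rw [hfq, hfq]
      exact (hq hz).trans (hC _ _ (by linarith) (by linarith) (by linarith))
    calc ∫⁻ y in Eset x, f (x - y) * f y * 1
        ≤ ∫⁻ y in Eset x, ((Dset x).indicator (fun y => f (x - y) * f y * 1) y
            + ((C * f x) * f (x - y) + (C * f x) * f y)) := by
          apply setLIntegral_mono' (aux_Eset x)
          intro y hy
          by_cases hD : y ∈ Dset x
          · rw [indicator_of_mem hD]; exact le_self_add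
          · refine le_trans ?_ le_add_self
            by_cases h1 : ‖x‖ - 1 ≤ ‖y‖
            · refine le_trans ?_ le_self_add
              rw [mul_one, mul_comm]
              gcongr
              exact hfar y h1
            · refine le_trans ?_ le_add_self
              rw [mul_one]
              gcongr
              apply hfar
              by_contra h2
              push Not at h1 h2
              exact hD ⟨h1, h2⟩
      _ ≤ ∫⁻ y, ((Dset x).indicator (fun y => f (x - y) * f y * 1) y
            + ((C * f x) * f (x - y) + (C * f x) * f y)) := setLIntegral_le_lintegral _ _
      _ = _ := by
          have hm : Measurable fun y => f (x - y) := hmeas.comp (measurable_const.sub measurable_id)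
          have hm2 : Measurable fun y => (C * f x) * f (x - y) + (C * f x) * f y :=
            (hm.const_mul _).add (hmeas.const_mul _)
          rw [lintegral_add_right _ hm2,
            lintegral_indicator (aux_Dset x), lintegral_add_right _ (hmeas.const_mul _),
            lintegral_const_mul _ hmeas, lintegral_const_mul _ hm,
            lintegral_sub_left_eq_self f x]
          ring
  change (∫⁻ y in Eset x, f (x - y) * f y * 1) / f x ≤
    (∫⁻ y in Dset x, f (x - y) * f y * 1) / f x + _
  refine (ENNReal.div_le_div_right key _).trans ?_
  rw [ENNReal.add_div]
  gcongr
  exact ENNReal.div_le_of_le_mul le_rfl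

/-- Under Assumption (A): if `h₂(x) → ∞` or `g₂(x) → ∞` as `|x| → ∞`, then
for all integers `n > m ≥ 1` (here `hfun f m = h_{m+1}`, `hfun f n = h_{n+1}`, `m < n`),
`h_{m+1}(x)/h_{n+1}(x) → 0` as `|x| → ∞`. -/
theorem stmt7 (d : ℕ) (hd : 0 < d) (f : EuclideanSpace ℝ (Fin d) → ℝ≥0∞)
    (hmeas : Measurable f) (hpos : ∀ x, 0 < f x) (hint : ∫⁻ x, f x ≠ ⊤)
    (q : ℝ → ℝ≥0∞) (hq : Antitone q) (hfq : ∀ x, f x = q ‖x‖)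
    (C₁ C₂ : ℝ) (hC₁ : 1 ≤ C₁) (hC₂ : 1 ≤ C₂)
    (hC1f : ∀ x y : EuclideanSpace ℝ (Fin d), 1 ≤ ‖x‖ → ‖x‖ ≤ ‖y‖ → ‖y‖ ≤ ‖x‖ + 1 →
      f x ≤ ENNReal.ofReal C₁ * f y)
    (hC2f : ∀ x : EuclideanSpace ℝ (Fin d), ‖x‖ ≤ 1 → f x ≤ ENNReal.ofReal C₂ * f ((2 : ℝ) • x))
    (hyp : Tendsto (hfun f 1) (normAtTop d) (𝓝 ⊤) ∨ Tendsto (gfun f 1) (normAtTop d) (𝓝 ⊤)) :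
    ∀ m n : ℕ, m < n →
      Tendsto (fun x => hfun f m x / hfun f n x) (normAtTop d) (𝓝 0) := by
  have hC : ∀ r s : ℝ, 1 ≤ r → r ≤ s → s ≤ r + 1 → q r ≤ ENNReal.ofReal C₁ * q s := by
    intro r s h1 h2 h3
    obtain ⟨x, hx⟩ := aux_vec hd r (by linarith)
    obtain ⟨y, hy⟩ := aux_vec hd s (by linarith)
    have := hC1f x y (by rw [hx]; exact h1) (by rw [hx, hy]; exact h2) (by rw [hx, hy]; exact h3)
    rwa [hfq, hfq, hx, hy] at this
  have hh : Tendsto (hfun f 1) (normAtTop d) (𝓝 ⊤) := by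
    rcases hyp with hyp | hyp
    · exact hyp
    · set K := 2 * ENNReal.ofReal C₁ * ∫⁻ x, f x with hK
      have hKt : K ≠ ⊤ := ENNReal.mul_ne_top (ENNReal.mul_ne_top (by simp) (by simp)) hint
      rw [ENNReal.tendsto_nhds_top_iff_nnreal] at hyp ⊢
      intro a
      lift K to NNReal using hKt with K'
      filter_upwards [hyp (a + K'), aux_g f hmeas q hq hfq _ hC] with x hx hx2
      rw [← hK] at hx2
      have := hx.trans_le hx2
      push_cast at this
      exact (ENNReal.add_lt_add_iff_right (by simp)).1 this
  have main : ∀ n : ℕ, (∀ ε : ℝ≥0∞, ε ≠ 0 → ε ≠ ⊤ → ∀ᶠ x in normAtTop d,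
      hfun f n x ≤ ε * hfun f (n + 1) x) ∧ Tendsto (hfun f (n + 1)) (normAtTop d) (𝓝 ⊤) := by
    intro n
    induction n with
    | zero =>
      refine ⟨fun ε h0 ht => ?_, hh⟩
      filter_upwards [hh.eventually (lt_mem_nhds (ENNReal.inv_lt_top.2 (pos_iff_ne_zero.2 h0)))]
        with x hx
      change (1 : ℝ≥0∞) ≤ _
      calc (1 : ℝ≥0∞) = ε * ε⁻¹ := (ENNReal.mul_inv_cancel h0 ht).symm
        _ ≤ _ := by gcongr
    | succ n ih =>
      obtain ⟨ih1, ih2⟩ := ih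
      have A : ∀ ε : ℝ≥0∞, ε ≠ 0 → ε ≠ ⊤ → ∀ᶠ x in normAtTop d,
          hfun f (n + 1) x ≤ ε * hfun f (n + 2) x := by
        intro ε h0 ht
        have hε2 : ε / 2 ≠ ⊤ := ENNReal.div_ne_top ht (by simp)
        obtain ⟨K, hK, hev⟩ := aux_step hd f hmeas hpos hint q hq hfq _ ENNReal.ofReal_ne_top hC n
          (ε / 2) hε2 (ih1 (ε / 2) (ENNReal.div_ne_zero.2 ⟨h0, by simp⟩) hε2)
        have h2K : K * 2 < ⊤ := (ENNReal.mul_ne_top hK (by simp)).lt_top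
        filter_upwards [hev, ih2.eventually (lt_mem_nhds h2K)] with x hx hx2
        have hfin : hfun f (n + 1) x ≠ ⊤ := by
          obtain ⟨M, hM, hb⟩ := aux_bdd hd f hpos hint q hq hfq (n + 1) ‖x‖ (norm_nonneg x)
          exact ne_top_of_le_ne_top hM (hb x le_rfl)
        have h3 : K ≤ hfun f (n + 1) x / 2 :=
          (ENNReal.le_div_iff_mul_le (by simp) (by simp)).2 hx2.le
        have h4 : hfun f (n + 1) x / 2 + hfun f (n + 1) x / 2 ≤
            ε / 2 * hfun f (n + 2) x + hfun f (n + 1) x / 2 := by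
          rw [ENNReal.add_halves]; exact hx.trans (by gcongr)
        have h5 := (ENNReal.add_le_add_iff_right (ENNReal.div_ne_top hfin (by simp))).1 h4
        calc hfun f (n + 1) x = hfun f (n + 1) x / 2 + hfun f (n + 1) x / 2 :=
              (ENNReal.add_halves _).symm
          _ ≤ ε / 2 * hfun f (n + 2) x + ε / 2 * hfun f (n + 2) x := by gcongr
          _ = _ := by rw [← add_mul, ENNReal.add_halves]
      refine ⟨A, ?_⟩
      refine tendsto_nhds_top_mono ih2 ?_
      filter_upwards [A 1 (by simp) (by simp)] with x hx
      simpa using hx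
  have main2 : ∀ m k : ℕ, ∀ ε : ℝ≥0∞, ε ≠ 0 → ε ≠ ⊤ → ∀ᶠ x in normAtTop d,
      hfun f m x ≤ ε * hfun f (m + k + 1) x := by
    intro m k
    induction k with
    | zero => exact (main m).1
    | succ k ih =>
      intro ε h0 ht
      filter_upwards [ih ε h0 ht, (main (m + k + 1)).1 1 (by simp) (by simp)] with x h1 h2
      rw [one_mul] at h2
      exact h1.trans (mul_le_mul_right h2 ε)
  intro m n hmn
  obtain ⟨k, rfl⟩ := Nat.exists_eq_add_of_lt hmn
  rw [ENNReal.tendsto_nhds_zero]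
  intro ε hε
  have hmin : min ε 1 ≠ ⊤ := (lt_of_le_of_lt (min_le_right _ _) ENNReal.one_lt_top).ne
  filter_upwards [main2 m k (min ε 1) (lt_min hε one_pos).ne' hmin] with x hx
  exact (ENNReal.div_le_of_le_mul hx).trans (min_le_left _ _)
end
end

section
/- Let f satisfy Assumption (A) and suppose h₂(x) → ∞ as |x| → ∞ (equivalently, g₂(x) → ∞ as |x| → ∞). Then for every n ∈ ℕ one has f^{n⋆}(x)/(f(x) h_n(x)) → 1 and f^{n⋆}(x)/(f(x) g_n(x)) → 1 as |x| → ∞. In particular, for all integers 1 ≤ m < n, f^{n⋆}(x)/f^{m⋆}(x) → ∞ as |x| → ∞, and for every n ∈ ℕ and λ > 0, p_λ(x)/f^{n⋆}(x) → ∞ as |x| → ∞. -/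
open MeasureTheory Filter Topology ENNReal Set

noncomputable section

/-- `iterConv f n` is the `(n+1)`-fold convolution `f^{(n+1)⋆}`. -/
def iterConv {d : ℕ} (f : EuclideanSpace ℝ (Fin d) → ℝ≥0∞) :
    ℕ → EuclideanSpace ℝ (Fin d) → ℝ≥0∞
  | 0 => f
  | n + 1 => fun x => ∫⁻ y, f (x - y) * iterConv f n y

/-- The density `p_λ(x) = e^{-λ‖f‖₁} ∑_{n=1}^∞ λⁿ f^{n⋆}(x)/n!`. -/
def pdens {d : ℕ} (f : EuclideanSpace ℝ (Fin d) → ℝ≥0∞) (lam : ℝ)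
    (x : EuclideanSpace ℝ (Fin d)) : ℝ≥0∞ :=
  ENNReal.ofReal (Real.exp (-(lam * (∫⁻ y, f y).toReal))) *
    ∑' n : ℕ, ENNReal.ofReal lam ^ (n + 1) * iterConv f n x / (Nat.factorial (n + 1) : ℝ≥0∞)

section aux

variable {d : ℕ}

local notation "𝔼" d => EuclideanSpace ℝ (Fin d)

def RD (G : (𝔼 d) → ℝ≥0∞) : Prop := ∀ x y, ‖x‖ ≤ ‖y‖ → G y ≤ G x

lemma ev_iff {p : (𝔼 d) → Prop} :
    (∀ᶠ x in normAtTop d, p x) ↔ ∃ R : ℝ, ∀ x, R ≤ ‖x‖ → p x := by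
  unfold normAtTop
  rw [Filter.eventually_comap]
  rw [Filter.eventually_atTop]
  constructor
  · rintro ⟨R, h⟩
    exact ⟨R, fun x hx => h _ hx x rfl⟩
  · rintro ⟨R, h⟩
    exact ⟨R, fun b hb x hx => h x (hx ▸ hb)⟩

lemma ev_norm (R : ℝ) : ∀ᶠ x in normAtTop d, R ≤ ‖x‖ := ev_iff.2 ⟨R, fun _ h => h⟩

/-- two-by-two rearrangement inequality -/
lemma rearr {a b u v : ℝ≥0∞} (h1 : b ≤ a) (h2 : v ≤ u) : b * u + a * v ≤ a * u + b * v := by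
  obtain ⟨c, rfl⟩ := exists_add_of_le h1
  obtain ⟨e, rfl⟩ := exists_add_of_le h2
  have : (b + c) * (v + e) + b * v = b * (v + e) + (b + c) * v + c * e := by ring
  rw [this]
  exact le_self_add

def conv2 (f g : (𝔼 d) → ℝ≥0∞) (x : 𝔼 d) : ℝ≥0∞ := ∫⁻ y, f (x - y) * g y

lemma sigma_geom (x x' : 𝔼 d) (hne : x' - x ≠ 0) (hx : ‖x‖ ≤ ‖x'‖) :
    ∃ σ : (𝔼 d) → (𝔼 d), MeasurePreserving σ volume volume ∧
      (∀ y, ‖x - σ y‖ = ‖x' - y‖) ∧ (∀ y, ‖x' - σ y‖ = ‖x - y‖) ∧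
      (∀ y, ‖x - y‖ ≤ ‖x' - y‖ → ‖y‖ ≤ ‖σ y‖) ∧
      (∀ y, ‖x' - y‖ ≤ ‖x - y‖ → ‖σ y‖ ≤ ‖y‖) := by
  set v := x' - x with hv
  let ρ := (ℝ ∙ v)ᗮ.reflection
  have hρv : ρ v = -v := Submodule.reflection_orthogonalComplement_singleton_eq_neg v
  have hx' : x' = x + v := by rw [hv]; abel
  have hvv : (0:ℝ) < inner ℝ v v := real_inner_self_pos.2 hne
  have hform : ∀ y : 𝔼 d, ρ (y - x) + x' =
      y + (1 - 2 * inner ℝ (y - x) v / inner ℝ v v) • v := by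
    intro y
    have h1 : ρ (y - x) = (y - x) - (2 * inner ℝ (y - x) v / inner ℝ v v) • v := by
      set w := y - x
      set a : ℝ := inner ℝ w v / inner ℝ v v
      have hdec : w = (w - a • v) + a • v := by abel
      have hmem : w - a • v ∈ (ℝ ∙ v)ᗮ := by
        rw [Submodule.mem_orthogonal_singleton_iff_inner_left]
        rw [inner_sub_left, inner_smul_left]
        simp only [a, conj_trivial]
        field_simp
        ring
      have : ρ w = (w - a • v) + a • (-v) := by
        conv_lhs => rw [hdec]
        rw [map_add, map_smul, hρv]
        congr 1
        exact Submodule.reflection_mem_subspace_eq_self hmem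
      rw [this]
      have h2 : 2 * inner ℝ w v / inner ℝ v v = 2 * a := by simp only [a]; ring
      rw [h2]; module
    rw [h1, hx']; module
  have hnorm : ∀ y : 𝔼 d, ‖ρ (y - x) + x'‖ ^ 2 - ‖y‖ ^ 2 =
      (1 - 2 * inner ℝ (y - x) v / inner ℝ v v) * (‖x'‖ ^ 2 - ‖x‖ ^ 2) := by
    intro y
    rw [hform y]
    have hb : inner ℝ (y - x) v = inner ℝ y v - inner ℝ x v := inner_sub_left _ _ _
    rw [hx', norm_add_sq_real, norm_add_sq_real, norm_smul, inner_smul_right, hb, mul_pow,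
      Real.norm_eq_abs, sq_abs, ← real_inner_self_eq_norm_sq v]
    field_simp
    ring
  have hcmp : ∀ y : 𝔼 d, ‖x' - y‖ ^ 2 - ‖x - y‖ ^ 2 =
      (1 - 2 * inner ℝ (y - x) v / inner ℝ v v) * inner ℝ v v := by
    intro y
    have : x' - y = (x - y) + v := by rw [hx']; abel
    rw [this, norm_add_sq_real, ← real_inner_self_eq_norm_sq v]
    have : inner ℝ (x - y) v = - inner ℝ (y - x) v := by
      rw [← inner_neg_left]; congr 1; abel
    rw [this]
    field_simp
    ring
  refine ⟨fun y => ρ (y - x) + x', ?_, ?_, ?_, ?_, ?_⟩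
  · exact (measurePreserving_add_right volume x').comp
      (ρ.measurePreserving.comp (measurePreserving_sub_right volume x))
  · intro y
    have : x - (ρ (y - x) + x') = ρ (x' - y) := by
      have : x' - y = v - (y - x) := by rw [hv]; abel
      rw [this, map_sub ρ v, hρv, hv]; abel
    rw [this, ρ.norm_map]
  · intro y
    have : x' - (ρ (y - x) + x') = ρ (x - y) := by
      rw [← neg_sub y x, map_neg]; abel
    rw [this, ρ.norm_map]
  · intro y hy
    have h1 : 0 ≤ (1 - 2 * inner ℝ (y - x) v / inner ℝ v v) * inner ℝ v v := by
      rw [← hcmp]; have := pow_le_pow_left₀ (norm_nonneg _) hy 2; linarith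
    have h2 : 0 ≤ (1 - 2 * inner ℝ (y - x) v / inner ℝ v v) := nonneg_of_mul_nonneg_left h1 hvv
    have h3 := hnorm y
    have h4 := pow_le_pow_left₀ (norm_nonneg _) hx 2
    have h5 := mul_nonneg h2 (sub_nonneg.2 h4)
    exact (sq_le_sq₀ (norm_nonneg _) (norm_nonneg _)).1 (by linarith)
  · intro y hy
    have h1 : (1 - 2 * inner ℝ (y - x) v / inner ℝ v v) * inner ℝ v v ≤ 0 := by
      rw [← hcmp]; have := pow_le_pow_left₀ (norm_nonneg _) hy 2; linarith
    have h2 : (1 - 2 * inner ℝ (y - x) v / inner ℝ v v) ≤ 0 := nonpos_of_mul_nonpos_left h1 hvv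
    have h3 := hnorm y
    have h4 := pow_le_pow_left₀ (norm_nonneg _) hx 2
    have h5 := mul_nonpos_of_nonpos_of_nonneg h2 (sub_nonneg.2 h4)
    exact (sq_le_sq₀ (norm_nonneg _) (norm_nonneg _)).1 (by linarith)

lemma RD.eq {G : (𝔼 d) → ℝ≥0∞} (h : RD G) {x y : 𝔼 d} (hxy : ‖x‖ = ‖y‖) : G x = G y :=
  le_antisymm (h _ _ hxy.ge) (h _ _ hxy.le)

lemma conv2_RD {f g : (𝔼 d) → ℝ≥0∞} (hf : Measurable f) (hg : Measurable g)
    (hf' : RD f) (hg' : RD g) : RD (conv2 f g) := by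
  intro x x' hx
  by_cases hne : x' - x = 0
  · rw [sub_eq_zero.1 hne]
  obtain ⟨σ, hσ, h1, h2, h3, h4⟩ := sigma_geom x x' hne hx
  have m1 : ∀ z : 𝔼 d, Measurable fun y => f (z - y) * g y := fun z =>
    (hf.comp (measurable_const.sub measurable_id)).mul hg
  have e1 : conv2 f g x = ∫⁻ y, f (x' - y) * g (σ y) := by
    unfold conv2
    rw [← hσ.lintegral_comp (m1 x)]
    refine lintegral_congr fun y => ?_
    rw [hf'.eq (h1 y)]
  have e2 : conv2 f g x' = ∫⁻ y, f (x - y) * g (σ y) := by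
    unfold conv2
    rw [← hσ.lintegral_comp (m1 x')]
    refine lintegral_congr fun y => ?_
    rw [hf'.eq (h2 y)]
  have key : conv2 f g x' + conv2 f g x' ≤ conv2 f g x + conv2 f g x := by
    conv_lhs => enter [2]; rw [e2]
    conv_rhs => enter [2]; rw [e1]
    unfold conv2
    rw [← lintegral_add_left (m1 x'), ← lintegral_add_left (m1 x)]
    refine lintegral_mono fun y => ?_
    rcases le_total ‖x - y‖ ‖x' - y‖ with h | h
    · exact rearr (hf' _ _ h) (hg' _ _ (h3 y h))
    · have := rearr (hf' _ _ h) (hg' _ _ (h4 y h))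
      simp only
      rw [add_comm (f (x' - y) * g y), add_comm (f (x - y) * g y)]
      exact this
  rw [← two_mul, ← two_mul] at key
  exact (ENNReal.mul_le_mul_iff_right (by norm_num) (by norm_num)).1 key

variable {f : (𝔼 d) → ℝ≥0∞}

lemma F_meas (hf : Measurable f) : ∀ n, Measurable (iterConv f n)
  | 0 => hf
  | n + 1 => by
    have ih := F_meas hf n
    have : Measurable (Function.uncurry fun x y : 𝔼 d => f (x - y) * iterConv f n y) :=
      (hf.comp (measurable_fst.sub measurable_snd)).mul (ih.comp measurable_snd)
    exact this.lintegral_prod_right'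

lemma m1 (hf : Measurable f) (n : ℕ) (x : 𝔼 d) :
    Measurable fun y => f (x - y) * iterConv f n y :=
  (hf.comp (measurable_const.sub measurable_id)).mul (F_meas hf n)

lemma F_RD (hf : Measurable f) (hf' : RD f) : ∀ n, RD (iterConv f n)
  | 0 => hf'
  | n + 1 => conv2_RD hf (F_meas hf n) hf' (F_RD hf hf' n)

lemma F_int (hf : Measurable f) (hint : ∫⁻ x, f x ≠ ⊤) : ∀ n, ∫⁻ x, iterConv f n x ≠ ⊤
  | 0 => hint
  | n + 1 => by
    have ih := F_int hf hint n
    have : Measurable (Function.uncurry fun x y : 𝔼 d => f (x - y) * iterConv f n y) :=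
      (hf.comp (measurable_fst.sub measurable_snd)).mul ((F_meas hf n).comp measurable_snd)
    show ∫⁻ x, ∫⁻ y, f (x - y) * iterConv f n y ≠ ⊤
    rw [lintegral_lintegral_swap this.aemeasurable]
    have : ∀ y : 𝔼 d, ∫⁻ x, f (x - y) * iterConv f n y = (∫⁻ x, f x) * iterConv f n y := by
      intro y
      have hm : Measurable fun x : 𝔼 d => f (x - y) := hf.comp (measurable_id.sub measurable_const)
      rw [lintegral_mul_const _ hm, lintegral_sub_right_eq_self]
    simp_rw [this]
    rw [lintegral_const_mul _ (F_meas hf n)]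
    exact ENNReal.mul_ne_top hint ih

lemma fin_of_RD {G : (𝔼 d) → ℝ≥0∞} (hG : RD G) (hint : ∫⁻ x, G x ≠ ⊤) {x : 𝔼 d} (hx : 0 < ‖x‖) :
    G x ≠ ⊤ := by
  intro h
  apply hint
  rw [eq_top_iff]
  calc ⊤ = ⊤ * volume (Metric.ball (0 : 𝔼 d) ‖x‖) := by
        rw [ENNReal.top_mul (Metric.measure_ball_pos volume _ hx).ne']
    _ = ∫⁻ y in Metric.ball (0 : 𝔼 d) ‖x‖, ⊤ := by rw [setLIntegral_const]
    _ ≤ ∫⁻ y in Metric.ball (0 : 𝔼 d) ‖x‖, G y := by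
        refine setLIntegral_mono' measurableSet_ball fun y hy => ?_
        rw [← h]
        exact hG _ _ (by simpa using (mem_ball_zero_iff.1 hy).le)
    _ ≤ ∫⁻ y, G y := setLIntegral_le_lintegral _ _

lemma F_pos (hf : Measurable f) (hpos : ∀ x, 0 < f x) : ∀ n x, 0 < iterConv f n x
  | 0, x => hpos x
  | n + 1, x => by
    show 0 < ∫⁻ y, f (x - y) * iterConv f n y
    rw [lintegral_pos_iff_support (m1 hf n x)]
    have : Function.support (fun y => f (x - y) * iterConv f n y) = univ := by
      ext y
      simp [(hpos (x - y)).ne', (F_pos hf hpos n y).ne']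
    rw [this]
    exact Measure.measure_univ_pos.2 (NeZero.ne _)

lemma f_shift_k {C : ℝ≥0∞} (hC : 1 ≤ C) (hf' : RD f)
    (hb : ∀ x y : 𝔼 d, 1 ≤ ‖x‖ → ‖x‖ ≤ ‖y‖ → ‖y‖ ≤ ‖x‖ + 1 → f x ≤ C * f y) (k : ℕ) :
    ∀ x y : 𝔼 d, 1 ≤ ‖x‖ → ‖y‖ ≤ ‖x‖ + k → f x ≤ C ^ k * f y := by
  induction k with
  | zero =>
    intro x y _ h
    simpa using hf' _ _ (by simpa using h)
  | succ k ih =>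
    intro x y hx h
    rcases le_total ‖y‖ (‖x‖ + k) with h1 | h1
    · refine (ih x y hx h1).trans ?_
      gcongr
      exact Nat.le_succ k
    · have hk : (0 : ℝ) ≤ k := Nat.cast_nonneg k
      have hy : 0 < ‖y‖ := by linarith
      set y' : 𝔼 d := ((‖x‖ + k) / ‖y‖) • y with hy'
      have hn : ‖y'‖ = ‖x‖ + k := by
        rw [hy', norm_smul, Real.norm_eq_abs, abs_of_nonneg (by positivity)]
        field_simp
      push_cast at h
      calc f x ≤ C ^ k * f y' := ih x y' hx hn.le
        _ ≤ C ^ k * (C * f y) := by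
          gcongr
          exact hb _ _ (by linarith) (by linarith) (by linarith)
        _ = C ^ (k + 1) * f y := by ring

/-- Everything derived from Assumption (A) that is used below. -/
structure Good (f : (𝔼 d) → ℝ≥0∞) : Prop where
  meas : Measurable f
  rd : RD f
  int : ∫⁻ x, f x ≠ ⊤
  pos : ∀ x, 0 < f x
  shift : ∀ R : ℝ, ∃ K : ℝ≥0∞, K ≠ ⊤ ∧ ∀ᶠ x in normAtTop d, ∀ z, ‖x‖ - R ≤ ‖z‖ → f z ≤ K * f x
  base : ∀ K : ℝ≥0∞, K ≠ ⊤ → ∀ᶠ x in normAtTop d, K * f x ≤ iterConv f 1 x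

lemma f_shift {C : ℝ≥0∞} (hC : 1 ≤ C) (hC' : C ≠ ⊤) (hf' : RD f)
    (hb : ∀ x y : 𝔼 d, 1 ≤ ‖x‖ → ‖x‖ ≤ ‖y‖ → ‖y‖ ≤ ‖x‖ + 1 → f x ≤ C * f y) (R : ℝ) :
    ∃ K : ℝ≥0∞, K ≠ ⊤ ∧ ∀ᶠ x in normAtTop d, ∀ z, ‖x‖ - R ≤ ‖z‖ → f z ≤ K * f x := by
  refine ⟨C ^ ⌈R⌉₊, ENNReal.pow_ne_top hC', ?_⟩
  filter_upwards [ev_norm (R + 1)] with x hx z hz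
  have := Nat.le_ceil R
  exact f_shift_k hC hf' hb _ _ _ (by linarith) (by linarith)

lemma Good.fin (hf : Good f) (n : ℕ) {x : 𝔼 d} (hx : 0 < ‖x‖) : iterConv f n x ≠ ⊤ :=
  fin_of_RD (F_RD hf.meas hf.rd n) (F_int hf.meas hf.int n) hx

lemma ev_pos : ∀ᶠ x in normAtTop d, 0 < ‖x‖ :=
  (ev_norm 1).mono fun _ h => lt_of_lt_of_le one_pos h

lemma D_sub_E (x : 𝔼 d) : Dset x ⊆ Eset x := fun y hy =>
  ⟨by have := hy.1; linarith, by have := hy.2; linarith⟩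

lemma h_le_g : ∀ n (x : 𝔼 d), hfun f n x ≤ gfun f n x
  | 0, _ => le_rfl
  | n + 1, x => by
    show (∫⁻ y in Dset x, f (x - y) * f y * hfun f n y) / f x ≤
      (∫⁻ y in Eset x, f (x - y) * f y * gfun f n y) / f x
    gcongr
    · exact D_sub_E x
    · exact h_le_g n _

lemma g_le_F : ∀ n (x : 𝔼 d), f x * gfun f n x ≤ iterConv f n x
  | 0, x => by simp [gfun, iterConv]
  | n + 1, x => by
    show f x * ((∫⁻ y in Eset x, f (x - y) * f y * gfun f n y) / f x) ≤
      ∫⁻ y, f (x - y) * iterConv f n y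
    refine ENNReal.mul_div_le.trans ((setLIntegral_le_lintegral _ _).trans ?_)
    refine lintegral_mono fun y => ?_
    simp only
    rw [mul_assoc]
    gcongr
    exact g_le_F n y

lemma super (hf : Good f) (n : ℕ) :
    (∀ K : ℝ≥0∞, K ≠ ⊤ → ∀ᶠ x in normAtTop d, K * iterConv f n x ≤ iterConv f (n + 1) x) ∧
    (∀ K : ℝ≥0∞, K ≠ ⊤ → ∀ᶠ x in normAtTop d, K * f x ≤ iterConv f (n + 1) x) := by
  induction n with
  | zero => exact ⟨hf.base, hf.base⟩
  | succ n ih =>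
    have first : ∀ K : ℝ≥0∞, K ≠ ⊤ →
        ∀ᶠ x in normAtTop d, K * iterConv f (n + 1) x ≤ iterConv f (n + 2) x := by
      intro K hK
      obtain ⟨R, hR⟩ := ev_iff.1 (ih.1 (2 * K) (ENNReal.mul_ne_top (by norm_num) hK))
      obtain ⟨L, hL, hLs⟩ := hf.shift R
      have hI := F_int hf.meas hf.int n
      filter_upwards [hLs, ih.2 (2 * (L * ∫⁻ y, iterConv f n y))
        (ENNReal.mul_ne_top (by norm_num) (ENNReal.mul_ne_top hL hI)), ev_pos] with x h1 h2 hx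
      have hpt : ∀ y, (2 * K) * (f (x - y) * iterConv f n y) ≤
          f (x - y) * iterConv f (n + 1) y + (2 * K * (L * f x)) * iterConv f n y := by
        intro y
        rcases le_total R ‖y‖ with hy | hy
        · refine le_trans ?_ le_self_add
          calc (2 * K) * (f (x - y) * iterConv f n y)
              = f (x - y) * ((2 * K) * iterConv f n y) := by ring
            _ ≤ _ := by gcongr; exact hR y hy
        · refine le_trans ?_ le_add_self
          have : f (x - y) ≤ L * f x := h1 _ (by have := norm_sub_norm_le x y; linarith)
          calc (2 * K) * (f (x - y) * iterConv f n y)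
              ≤ (2 * K) * ((L * f x) * iterConv f n y) := by gcongr
            _ = _ := by ring
      have hint := lintegral_mono (μ := (volume : Measure (𝔼 d))) hpt
      rw [lintegral_const_mul _ (m1 hf.meas n x), lintegral_add_left (m1 hf.meas (n + 1) x),
        lintegral_const_mul _ (F_meas hf.meas n)] at hint
      change 2 * K * iterConv f (n + 1) x ≤ iterConv f (n + 2) x + _ at hint
      have h3 : 2 * K * (L * f x) * ∫⁻ y, iterConv f n y ≤ K * iterConv f (n + 1) x := by
        calc 2 * K * (L * f x) * ∫⁻ y, iterConv f n y
            = K * (2 * (L * ∫⁻ y, iterConv f n y) * f x) := by ring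
          _ ≤ _ := by gcongr
      have h4 : K * iterConv f (n + 1) x + K * iterConv f (n + 1) x ≤
          iterConv f (n + 2) x + K * iterConv f (n + 1) x := by
        calc _ = 2 * K * iterConv f (n + 1) x := by ring
          _ ≤ _ := hint.trans (by gcongr)
      exact (ENNReal.add_le_add_iff_right (ENNReal.mul_ne_top hK (hf.fin _ hx))).1 h4
    refine ⟨first, fun K hK => ?_⟩
    filter_upwards [ih.2 K hK, first 1 (by norm_num)] with x h1 h2
    rw [one_mul] at h2
    exact h1.trans h2

lemma super_lt (hf : Good f) (m : ℕ) (k : ℕ) (K : ℝ≥0∞) (hK : K ≠ ⊤) :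
    ∀ᶠ x in normAtTop d, K * iterConv f m x ≤ iterConv f (m + k + 1) x := by
  induction k with
  | zero => exact (super hf m).1 K hK
  | succ k ih =>
    filter_upwards [ih, (super hf (m + k + 1)).1 1 (by norm_num)] with x h1 h2
    rw [one_mul] at h2
    exact h1.trans h2

lemma F_shift (hf : Good f) (n : ℕ) : ∃ K : ℝ≥0∞, K ≠ ⊤ ∧ ∀ᶠ x in normAtTop d, ∀ z,
    ‖x‖ - 1 ≤ ‖z‖ → iterConv f n z ≤ K * iterConv f n x := by
  induction n with
  | zero => exact hf.shift 1
  | succ n ih =>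
    obtain ⟨K, hK, hKs⟩ := ih
    obtain ⟨R, hR⟩ := ev_iff.1 hKs
    obtain ⟨L, hL, hLs⟩ := hf.shift R
    have hI := F_int hf.meas hf.int n
    refine ⟨K + L * ∫⁻ y, iterConv f n y,
      ENNReal.add_ne_top.2 ⟨hK, ENNReal.mul_ne_top hL hI⟩, ?_⟩
    filter_upwards [hLs, (super hf n).2 1 (by norm_num), ev_norm 1] with x h1 h2 hx z hz
    rw [one_mul] at h2
    set e : 𝔼 d := (1 / ‖x‖) • x with he
    have hx0 : 0 < ‖x‖ := by linarith
    have hen : ‖e‖ = 1 := by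
      rw [he, norm_smul, Real.norm_eq_abs, abs_of_nonneg (by positivity)]
      field_simp
    have hxe : ‖x - e‖ = ‖x‖ - 1 := by
      have : x - e = (1 - 1 / ‖x‖) • x := by rw [he]; module
      rw [this, norm_smul, Real.norm_eq_abs, abs_of_nonneg]
      · field_simp
      · rw [sub_nonneg, div_le_one hx0]; exact hx
    have hmF : Measurable fun y : 𝔼 d => iterConv f n (y - e) :=
      (F_meas hf.meas n).comp (measurable_id.sub measurable_const)
    have hpt : ∀ y, f (x - y) * iterConv f n (y - e) ≤
        K * (f (x - y) * iterConv f n y) + (L * f x) * iterConv f n (y - e) := by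
      intro y
      rcases le_total R ‖y‖ with hy | hy
      · refine le_trans ?_ le_self_add
        calc f (x - y) * iterConv f n (y - e) ≤ f (x - y) * (K * iterConv f n y) := by
              gcongr
              refine hR y hy _ ?_
              have := norm_sub_norm_le y e
              linarith
          _ = _ := by ring
      · refine le_trans ?_ le_add_self
        have : f (x - y) ≤ L * f x := h1 _ (by have := norm_sub_norm_le x y; linarith)
        gcongr
    have hint := lintegral_mono (μ := (volume : Measure (𝔼 d))) hpt
    rw [lintegral_add_right _ (hmF.const_mul _), lintegral_const_mul _ (m1 hf.meas n x),
      lintegral_const_mul _ hmF, lintegral_sub_right_eq_self (fun y => iterConv f n y) e] at hint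
    have heq : iterConv f (n + 1) (x - e) = ∫⁻ y, f (x - y) * iterConv f n (y - e) := by
      show ∫⁻ y, f (x - e - y) * iterConv f n y = _
      rw [← lintegral_sub_right_eq_self _ e]
      refine lintegral_congr fun y => ?_
      congr 2
      abel
    calc iterConv f (n + 1) z ≤ iterConv f (n + 1) (x - e) :=
          F_RD hf.meas hf.rd _ _ _ (by rw [hxe]; exact hz)
      _ ≤ K * iterConv f (n + 1) x + L * f x * ∫⁻ y, iterConv f n y := by rw [heq]; exact hint
      _ ≤ K * iterConv f (n + 1) x + L * iterConv f (n + 1) x * ∫⁻ y, iterConv f n y := by gcongr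
      _ = _ := by ring

lemma upper (hf : Good f) (n : ℕ) : ∀ ε : ℝ≥0∞, ε ≠ 0 → ε ≠ ⊤ → ∀ᶠ x in normAtTop d,
    iterConv f n x ≤ f x * hfun f n x + ε * iterConv f n x := by
  induction n with
  | zero =>
    intro ε _ _
    refine Eventually.of_forall fun x => ?_
    simp [hfun, iterConv]
  | succ n ih =>
    intro ε hε hε'
    have he4 : ε / 4 ≠ 0 := by simp [hε]
    have he4' : ε / 4 ≠ ⊤ := ENNReal.div_ne_top hε' (by norm_num)
    obtain ⟨R, hR⟩ := ev_iff.1 (ih (ε / 4) he4 he4')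
    obtain ⟨L, hL, hLs⟩ := hf.shift R
    obtain ⟨M, hM, hMs⟩ := hf.shift 1
    obtain ⟨K, hK, hKs⟩ := F_shift hf n
    have hI := F_int hf.meas hf.int n
    have hinv : (ε / 4)⁻¹ ≠ ⊤ := ENNReal.inv_ne_top.2 he4
    filter_upwards [hLs, hMs, hKs, ev_pos,
      (super hf n).1 ((ε / 4)⁻¹ * (K * ∫⁻ y, f y))
        (ENNReal.mul_ne_top hinv (ENNReal.mul_ne_top hK hf.int)),
      (super hf n).2 ((ε / 4)⁻¹ * ((L + M) * ∫⁻ y, iterConv f n y))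
        (ENNReal.mul_ne_top hinv (ENNReal.mul_ne_top (ENNReal.add_ne_top.2 ⟨hL, hM⟩) hI))]
      with x h1 h2 h3 hx h5 h6
    have hDm : MeasurableSet (Dset x) := by
      refine (measurableSet_lt measurable_norm measurable_const).inter
        (measurableSet_lt (measurable_const.sub measurable_id).norm measurable_const)
    have hfx : Measurable fun y : 𝔼 d => f (x - y) :=
      hf.meas.comp (measurable_const.sub measurable_id)
    have hpt : ∀ y, f (x - y) * iterConv f n y ≤
        (Dset x).indicator (fun y => f (x - y) * f y * hfun f n y) y +
        (ε / 4 * (f (x - y) * iterConv f n y) + (((L + M) * f x) * iterConv f n y +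
          (K * iterConv f n x) * f (x - y))) := by
      intro y
      rcases le_total ‖y‖ R with hy | hy
      · have : f (x - y) ≤ (L + M) * f x :=
          (h1 _ (by have := norm_sub_norm_le x y; linarith)).trans (by gcongr; exact le_self_add)
        calc f (x - y) * iterConv f n y ≤ ((L + M) * f x) * iterConv f n y := by gcongr
          _ ≤ _ := le_add_left (le_add_left le_self_add)
      · by_cases hD : y ∈ Dset x
        · rw [indicator_of_mem hD]
          calc f (x - y) * iterConv f n y
              ≤ f (x - y) * (f y * hfun f n y + ε / 4 * iterConv f n y) := by
                gcongr; exact hR y hy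
            _ = f (x - y) * f y * hfun f n y + ε / 4 * (f (x - y) * iterConv f n y) := by ring
            _ ≤ _ := by gcongr; exact le_self_add
        · have : ‖x‖ - 1 ≤ ‖y‖ ∨ ‖x‖ - 1 ≤ ‖x - y‖ := by
            by_contra hcon
            push Not at hcon
            exact hD hcon
          rcases this with h | h
          · calc f (x - y) * iterConv f n y ≤ f (x - y) * (K * iterConv f n x) := by
                  gcongr; exact h3 y h
              _ = (K * iterConv f n x) * f (x - y) := mul_comm _ _
              _ ≤ _ := le_add_left (le_add_left le_add_self)
          · have : f (x - y) ≤ (L + M) * f x := (h2 _ h).trans (by gcongr; exact le_add_self)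
            calc f (x - y) * iterConv f n y ≤ ((L + M) * f x) * iterConv f n y := by gcongr
              _ ≤ _ := le_add_left (le_add_left le_self_add)
    have hint := lintegral_mono (μ := (volume : Measure (𝔼 d))) hpt
    have ma := (m1 hf.meas n x).const_mul (ε / 4)
    have mb := (F_meas hf.meas n).const_mul ((L + M) * f x)
    have mc := hfx.const_mul (K * iterConv f n x)
    have hfull : ∫⁻ y, f (x - y) = ∫⁻ y, f y := lintegral_sub_left_eq_self _ _
    have mall : Measurable fun y : 𝔼 d => ε / 4 * (f (x - y) * iterConv f n y) +
        (((L + M) * f x) * iterConv f n y + (K * iterConv f n x) * f (x - y)) := ma.add (mb.add mc)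
    rw [lintegral_add_right _ mall, lintegral_add_left ma, lintegral_add_left mb,
      lintegral_const_mul _ (m1 hf.meas n x), lintegral_const_mul _ (F_meas hf.meas n),
      lintegral_const_mul _ hfx, lintegral_indicator hDm, hfull] at hint
    have hA : f x * hfun f (n + 1) x = ∫⁻ y in Dset x, f (x - y) * f y * hfun f n y :=
      ENNReal.mul_div_cancel (hf.pos x).ne' (hf.fin 0 hx)
    have key : ∀ a b c : ℝ≥0∞, (ε / 4)⁻¹ * a * b ≤ c → a * b ≤ ε / 4 * c := by
      intro a b c h
      calc a * b = ε / 4 * ((ε / 4)⁻¹ * a * b) := by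
            rw [← mul_assoc, ← mul_assoc, ENNReal.mul_inv_cancel he4 he4', one_mul]
        _ ≤ _ := by gcongr
    have k5 := key _ _ _ h5
    have k6 := key _ _ _ h6
    rw [hA]
    refine hint.trans ?_
    gcongr
    change ε / 4 * iterConv f (n + 1) x + _ ≤ _
    calc _ ≤ ε / 4 * iterConv f (n + 1) x +
          (ε / 4 * iterConv f (n + 1) x + ε / 4 * iterConv f (n + 1) x) := by
          refine add_le_add le_rfl (add_le_add ?_ ?_)
          · refine le_trans (le_of_eq ?_) k6; ring
          · refine le_trans (le_of_eq ?_) k5; ring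
      _ = (3 * (ε / 4)) * iterConv f (n + 1) x := by ring
      _ ≤ (4 * (ε / 4)) * iterConv f (n + 1) x := by gcongr; norm_num
      _ = _ := by rw [ENNReal.mul_div_cancel (by norm_num) (by norm_num)]

lemma ratio_one (hf : Good f) (n : ℕ) (A : (𝔼 d) → ℝ≥0∞)
    (h1 : ∀ x, f x * hfun f n x ≤ A x) (h2 : ∀ x, A x ≤ iterConv f n x) :
    Tendsto (fun x => iterConv f n x / A x) (normAtTop d) (𝓝 1) := by
  have key : Tendsto (fun x => A x / iterConv f n x) (normAtTop d) (𝓝 1) := by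
    rw [ENNReal.tendsto_nhds (by norm_num)]
    intro ε hε
    have hle : ∀ x, A x / iterConv f n x ≤ 1 := fun x => ENNReal.div_le_of_le_mul (by simpa using h2 x)
    rcases eq_or_ne ε ⊤ with rfl | hε'
    · refine Eventually.of_forall fun x => ?_
      simp
    filter_upwards [upper hf n ε hε.ne' hε', ev_pos] with x hx hx0
    refine ⟨?_, (hle x).trans le_self_add⟩
    rw [tsub_le_iff_right]
    have hp := (F_pos hf.meas hf.pos n x).ne'
    have ht := hf.fin n hx0
    calc 1 = iterConv f n x / iterConv f n x := (ENNReal.div_self hp ht).symm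
      _ ≤ (A x + ε * iterConv f n x) / iterConv f n x := by
        gcongr
        exact hx.trans (by gcongr; exact h1 x)
      _ = _ := by rw [ENNReal.add_div, ENNReal.mul_div_cancel_right hp ht]
  have h3 := (tendsto_inv_iff (a := (1 : ℝ≥0∞))).2 key
  rw [inv_one] at h3
  refine h3.congr' ?_
  filter_upwards [ev_pos] with x hx
  exact ENNReal.inv_div (Or.inl (hf.fin n hx)) (Or.inl (F_pos hf.meas hf.pos n x).ne')

lemma ratio_top (hf : Good f) (m n : ℕ) (hmn : m < n) :
    Tendsto (fun x => iterConv f n x / iterConv f m x) (normAtTop d) (𝓝 ⊤) := by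
  obtain ⟨k, rfl⟩ := Nat.exists_eq_add_of_lt hmn
  rw [ENNReal.tendsto_nhds_top_iff_nnreal]
  intro K
  filter_upwards [super_lt hf m k (K + 1) (by finiteness), ev_pos] with x hx hx0
  have hp := (F_pos hf.meas hf.pos m x).ne'
  have ht := hf.fin m hx0
  refine lt_of_lt_of_le (ENNReal.lt_add_right (by finiteness) one_ne_zero)
    ((ENNReal.le_div_iff_mul_le (Or.inl hp) (Or.inl ht)).2 hx)

lemma pdens_top (hf : Good f) (n : ℕ) (lam : ℝ) (hl : 0 < lam) :
    Tendsto (fun x => pdens f lam x / iterConv f n x) (normAtTop d) (𝓝 ⊤) := by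
  set c : ℝ≥0∞ := ENNReal.ofReal (Real.exp (-(lam * (∫⁻ y, f y).toReal))) *
    (ENNReal.ofReal lam ^ (n + 2) / (Nat.factorial (n + 2) : ℝ≥0∞)) with hc
  have hc0 : c ≠ 0 := by
    rw [hc]
    refine mul_ne_zero (by simp [Real.exp_pos]) ?_
    refine ENNReal.div_ne_zero.2 ⟨pow_ne_zero _ (by simpa using hl), ENNReal.natCast_ne_top _⟩
  have h := ENNReal.Tendsto.const_mul (a := c) (ratio_top hf n (n + 1) (Nat.lt_succ_self n))
    (Or.inl (by simp))
  rw [ENNReal.mul_top hc0] at h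
  refine tendsto_nhds_top_mono h (Eventually.of_forall fun x => ?_)
  simp only
  rw [← mul_div_assoc]
  gcongr
  rw [hc, mul_assoc]
  unfold pdens
  gcongr
  refine le_trans (le_of_eq ?_) (ENNReal.le_tsum (n + 1))
  simp only [div_eq_mul_inv]
  ring

end aux

/-- Under Assumption (A), if `h₂(x) → ∞` as `|x| → ∞`, then for every
`n ≥ 1` (written `n+1`) one has `f^{(n+1)⋆}(x)/(f(x) h_{n+1}(x)) → 1` and
`f^{(n+1)⋆}(x)/(f(x) g_{n+1}(x)) → 1`; for all `1 ≤ m+1 < n+1`,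
`f^{(n+1)⋆}(x)/f^{(m+1)⋆}(x) → ∞`; and for every `n` and `λ > 0`,
`p_λ(x)/f^{(n+1)⋆}(x) → ∞`, all as `|x| → ∞`. -/
theorem stmt10 (d : ℕ) (hd : 0 < d) (f : EuclideanSpace ℝ (Fin d) → ℝ≥0∞)
    (hmeas : Measurable f) (hpos : ∀ x, 0 < f x) (hint : ∫⁻ x, f x ≠ ⊤)
    (q : ℝ → ℝ≥0∞) (hq : Antitone q) (hfq : ∀ x, f x = q ‖x‖)
    (C₁ C₂ : ℝ) (hC₁ : 1 ≤ C₁) (hC₂ : 1 ≤ C₂)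
    (hC1f : ∀ x y : EuclideanSpace ℝ (Fin d), 1 ≤ ‖x‖ → ‖x‖ ≤ ‖y‖ → ‖y‖ ≤ ‖x‖ + 1 →
      f x ≤ ENNReal.ofReal C₁ * f y)
    (hC2f : ∀ x : EuclideanSpace ℝ (Fin d), ‖x‖ ≤ 1 → f x ≤ ENNReal.ofReal C₂ * f ((2 : ℝ) • x))
    (hyp : Tendsto (hfun f 1) (normAtTop d) (𝓝 ⊤)) :
    (∀ n : ℕ,
      Tendsto (fun x => iterConv f n x / (f x * hfun f n x)) (normAtTop d) (𝓝 1) ∧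
      Tendsto (fun x => iterConv f n x / (f x * gfun f n x)) (normAtTop d) (𝓝 1)) ∧
    (∀ m n : ℕ, m < n →
      Tendsto (fun x => iterConv f n x / iterConv f m x) (normAtTop d) (𝓝 ⊤)) ∧
    (∀ (n : ℕ) (lam : ℝ), 0 < lam →
      Tendsto (fun x => pdens f lam x / iterConv f n x) (normAtTop d) (𝓝 ⊤)) := by
  have hrd : RD f := fun x y h => by rw [hfq, hfq]; exact hq h
  have good : Good f := {
    meas := hmeas
    rd := hrd
    int := hint
    pos := hpos
    shift := f_shift (C := ENNReal.ofReal C₁) (by simpa using hC₁) ENNReal.ofReal_ne_top hrd hC1f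
    base := by
      intro K hK
      lift K to NNReal using hK with k
      filter_upwards [ENNReal.tendsto_nhds_top_iff_nnreal.1 hyp k] with x hx
      calc (k : ℝ≥0∞) * f x ≤ hfun f 1 x * f x := by gcongr
        _ = f x * hfun f 1 x := mul_comm _ _
        _ ≤ f x * gfun f 1 x := by gcongr; exact h_le_g 1 x
        _ ≤ _ := g_le_F 1 x }
  refine ⟨fun n => ⟨?_, ?_⟩, ?_, ?_⟩
  · refine ratio_one good n _ (fun x => le_rfl) fun x => ?_
    refine le_trans ?_ (g_le_F n x)
    gcongr
    exact h_le_g n x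
  · refine ratio_one good n _ (fun x => ?_) (g_le_F n)
    gcongr
    exact h_le_g n x
  · exact ratio_top good
  · exact pdens_top good
end
end
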